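/- There do not exist differentiable, everywhere-positive functions A, B, C : [0,∞) → ℝ satisfying the backward Ricci flow system of class U3S3 with strictly ordered initial data A(0) > B(0) > C(0) > 0; that is, every such solution with pairwise distinct initial values develops a singularity in finite time. -/

import Mathlib

open Real Set

lemma aux_mono (f f' : ℝ → ℝ) (h : ∀ t ∈ Set.Ici (0:ℝ), HasDerivWithinAt f (f' t) (Set.Ici 0) t)
    (h0 : ∀ t ∈ Set.Ici (0:ℝ), 0 ≤ f' t) : ∀ t ∈ Set.Ici (0:ℝ), f 0 ≤ f t := by
  have hm : MonotoneOn f (Set.Ici 0) := by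
    apply monotoneOn_of_deriv_nonneg (convex_Ici 0)
    · intro t ht
      exact (h t ht).continuousWithinAt
    · intro t ht
      exact ((h t (interior_subset ht)).mono interior_subset).differentiableWithinAt
    · intro t ht
      rw [((h t (interior_subset ht)).hasDerivAt (mem_interior_iff_mem_nhds.1 ht)).deriv]
      exact h0 t (interior_subset ht)
  intro t ht
  exact hm (by simp) ht ht

lemma aux_pos (f k : ℝ → ℝ) (hk : ContinuousOn k (Set.Ici 0))
    (h : ∀ t ∈ Set.Ici (0:ℝ), HasDerivWithinAt f (k t * f t) (Set.Ici 0) t)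
    (h0 : 0 < f 0) : ∀ t ∈ Set.Ici (0:ℝ), 0 < f t := by
  have hc : Continuous (fun t => k (max t 0)) :=
    hk.comp_continuous (by fun_prop) (fun t => le_max_right t 0)
  have hK : ∀ t, HasDerivAt (fun t => ∫ s in (0:ℝ)..t, k (max s 0)) (k (max t 0)) t :=
    fun t => (hc.integral_hasStrictDerivAt 0 t).hasDerivAt
  set K := fun t => ∫ s in (0:ℝ)..t, k (max s 0) with hKd
  have hg : ∀ t ∈ Set.Ici (0:ℝ), HasDerivWithinAt (fun t => f t * exp (-K t)) 0 (Set.Ici 0) t := by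
    intro t ht
    have h1 := (h t ht).mul ((hK t).neg.exp.hasDerivWithinAt (s := Set.Ici 0))
    refine h1.congr_deriv ?_
    rw [max_eq_left ht]
    simp only [Pi.neg_apply]
    ring
  intro t ht
  have := aux_mono _ (fun _ => 0) hg (fun _ _ => le_rfl) t ht
  have h2 : 0 < f t * exp (-K t) := lt_of_lt_of_le (by positivity) this
  exact pos_of_mul_pos_left h2 (exp_pos _).le

/-- There is no differentiable, everywhere-positive global solution on `[0,∞)` of the
backward Ricci flow system of class `U3S3` (`A' = (A² − (B−C)²)/(BC)`,
`B' = (B² − (A−C)²)/(AC)`, `C' = (C² − (A−B)²)/(AB)`) with strictly ordered initial data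
`A(0) > B(0) > C(0) > 0`: every such solution develops a singularity in finite time. -/
theorem stmt19 :
    ¬ ∃ A B C : ℝ → ℝ,
      (∀ t ∈ Set.Ici (0 : ℝ), 0 < A t ∧ 0 < B t ∧ 0 < C t) ∧
      (∀ t ∈ Set.Ici (0 : ℝ),
        HasDerivWithinAt A ((A t ^ 2 - (B t - C t) ^ 2) / (B t * C t)) (Set.Ici (0 : ℝ)) t) ∧
      (∀ t ∈ Set.Ici (0 : ℝ),
        HasDerivWithinAt B ((B t ^ 2 - (A t - C t) ^ 2) / (A t * C t)) (Set.Ici (0 : ℝ)) t) ∧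
      (∀ t ∈ Set.Ici (0 : ℝ),
        HasDerivWithinAt C ((C t ^ 2 - (A t - B t) ^ 2) / (A t * B t)) (Set.Ici (0 : ℝ)) t) ∧
      B 0 < A 0 ∧ C 0 < B 0 ∧ 0 < C 0 := by
  rintro ⟨A, B, C, hp, hA, hB, hC, hAB0, hBC0, hC0⟩
  have cA : ContinuousOn A (Set.Ici 0) := fun t ht => (hA t ht).continuousWithinAt
  have cB : ContinuousOn B (Set.Ici 0) := fun t ht => (hB t ht).continuousWithinAt
  have cC : ContinuousOn C (Set.Ici 0) := fun t ht => (hC t ht).continuousWithinAt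
  have hne : ∀ t ∈ Set.Ici (0:ℝ), A t * B t * C t ≠ 0 := by
    intro t ht
    obtain ⟨a, b, c⟩ := hp t ht
    positivity
  have hBC : ∀ t ∈ Set.Ici (0:ℝ), 0 < B t - C t := by
    apply aux_pos (fun t => B t - C t) (fun t => ((B t + C t)^2 - A t ^ 2) / (A t * B t * C t))
    · exact ContinuousOn.div (by fun_prop) (by fun_prop) hne
    · intro t ht
      obtain ⟨a, b, c⟩ := hp t ht
      refine ((hB t ht).sub (hC t ht)).congr_deriv ?_
      field_simp
      ring
    · exact sub_pos.2 hBC0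
  have hAB : ∀ t ∈ Set.Ici (0:ℝ), 0 < A t - B t := by
    apply aux_pos (fun t => A t - B t) (fun t => ((A t + B t)^2 - C t ^ 2) / (A t * B t * C t))
    · exact ContinuousOn.div (by fun_prop) (by fun_prop) hne
    · intro t ht
      obtain ⟨a, b, c⟩ := hp t ht
      refine ((hA t ht).sub (hB t ht)).congr_deriv ?_
      field_simp
      ring
    · exact sub_pos.2 hAB0
  have hCt : ∀ t ∈ Set.Ici (0:ℝ), C t ≤ C 0 + t := by
    intro t ht
    have := aux_mono (fun t => t - C t) _
      (fun t ht => (hasDerivWithinAt_id t _).sub (hC t ht)) ?_ t ht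
    · linarith
    · intro t ht
      obtain ⟨a, b, c⟩ := hp t ht
      have h1 := hAB t ht
      have h2 := hBC t ht
      rw [sub_nonneg, div_le_one (by positivity)]
      nlinarith [sq_nonneg (A t - B t), mul_pos h1 b, mul_pos h2 b, mul_pos h2 c]
  have hw := aux_mono (fun t => (A t - B t) / (A t * (C 0 + t))) _
      (fun t ht => ((hA t ht).sub (hB t ht)).div
        ((hA t ht).mul ((hasDerivWithinAt_id t _).const_add (C 0)))
        (by
          obtain ⟨a, b, c⟩ := hp t ht
          have : 0 ≤ t := ht
          positivity)) ?_
  · have a0 := (hp 0 (by simp)).1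
    set w := (A 0 - B 0) / (A 0 * (C 0 + 0)) with hwd
    have w0 : 0 < w := by
      have := sub_pos.2 hAB0
      simp only [hwd, add_zero]
      positivity
    have ht : (1 / w) ∈ Set.Ici (0:ℝ) := by
      simp only [Set.mem_Ici]
      positivity
    have h1 := hw (1 / w) ht
    obtain ⟨a, b, c⟩ := hp _ ht
    have : 0 < 1 / w := by positivity
    rw [le_div_iff₀ (by positivity)] at h1
    have h3 : w * (A (1/w) * (C 0 + 1 / w)) = A (1/w) + w * A (1/w) * C 0 := by
      field_simp
      ring
    have h4 : 0 < w * A (1/w) * C 0 := by positivity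
    linarith
  · intro t ht
    obtain ⟨a, b, c⟩ := hp t ht
    have h1 := hAB t ht
    have h2 := hBC t ht
    have h3 := hCt t ht
    have h0 : 0 ≤ t := ht
    simp only [Pi.sub_apply]
    apply div_nonneg _ (by positivity)
    have key : ((A t ^ 2 - (B t - C t) ^ 2) / (B t * C t) - (B t ^ 2 - (A t - C t) ^ 2) / (A t * C t)) * (A t * (C 0 + t)) - (A t - B t) * ((A t ^ 2 - (B t - C t) ^ 2) / (B t * C t) * (C 0 + t) + A t * 1) = (A t - B t) / C t * (2 * (A t + B t - C t) * (C 0 + t) - A t * C t) := by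
      field_simp
      ring
    rw [key]
    apply mul_nonneg (by positivity)
    have h5 : A t * C t ≤ A t * (C 0 + t) := by gcongr
    nlinarith [mul_pos a (by positivity : 0 < C 0 + t), mul_pos h2 (by positivity : 0 < C 0 + t)]
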